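/- For any letters a, b ∈ Σ with b ≠ a^{-1} and any ε > 0, the proportion of freely reduced words of length n in which the two-letter word ab occurs with frequency close to 1/(2k(2k−1)) tends to 1 exponentially fast: #{w ∈ F_k : |w| = n and w_{ab}/n ∈ (1/(2k(2k−1)) − ε, 1/(2k(2k−1)) + ε)} / γ(n,F_k) → 1 as n → ∞, and the convergence is exponentially fast (there exist K > 0 and 0 < σ < 1 with |1 − ratio| ≤ K σ^n). -/

import Mathlib

/-! Common definitions: free group `FG k = F(a_1,…,a_k)`, reduced and cyclically
reduced words, Whitehead automorphisms, strict minimality, counting functions and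
exponential genericity, following Kapovich–Schupp–Shpilrain. -/

/-- The free group of rank `k` on the basis `a_1,…,a_k`. -/
abbrev FG (k : ℕ) := FreeGroup (Fin k)

/-- The alphabet `Σ = {a_1,…,a_k}^{±1}`: a letter is a basis index together with a sign. -/
abbrev Letter (k : ℕ) := Fin k × Bool

/-- The inverse of a letter. -/
def linv {k : ℕ} (x : Letter k) : Letter k := (x.1, !x.2)

/-- The length `|g|` of the reduced word representing `g`. -/
def wordLength {k : ℕ} (g : FG k) : ℕ := (FreeGroup.toWord g).length

/-- A word is (freely) reduced if it equals its free reduction. -/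
def ReducedWord {k : ℕ} (w : List (Letter k)) : Prop := FreeGroup.reduce w = w

/-- A word is cyclically reduced if all of its cyclic permutations are reduced;
equivalently, `w ++ w` is reduced. -/
def CyclicallyReducedWord {k : ℕ} (w : List (Letter k)) : Prop :=
  FreeGroup.reduce (w ++ w) = w ++ w

/-- An element of `FG k` is cyclically reduced if its reduced word is. -/
def IsCyclicallyReduced {k : ℕ} (g : FG k) : Prop :=
  CyclicallyReducedWord (FreeGroup.toWord g)

/-- `C`, the set of all cyclically reduced elements of `FG k`. -/
def Cset (k : ℕ) : Set (FG k) := {g | IsCyclicallyReduced g}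

/-- The cyclic length `‖g‖`: the length of the cyclically reduced form of `g`
(the unique cyclically reduced `u` with `g = x u x⁻¹`). -/
noncomputable def cyclicLength {k : ℕ} (g : FG k) : ℕ :=
  sInf {n | ∃ x u : FG k, IsCyclicallyReduced u ∧ g = x * u * x⁻¹ ∧ wordLength u = n}

/-- The set `Σ = {a_1,…,a_k}^{±1}` inside the free group. -/
def letterSet (k : ℕ) : Set (FG k) :=
  {g | ∃ i : Fin k, g = FreeGroup.of i ∨ g = (FreeGroup.of i)⁻¹}

/-- A Whitehead automorphism of the first kind: a relabeling automorphism,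
i.e. one whose restriction to `Σ` is a permutation of `Σ`. -/
def IsRelabeling {k : ℕ} (τ : MulAut (FG k)) : Prop :=
  (⇑τ) '' letterSet k = letterSet k

/-- A Whitehead automorphism of the second kind, with multiplier `a ∈ Σ`:
`τ a = a` and `τ x ∈ {x, xa, a⁻¹x, a⁻¹xa}` for all `x ∈ Σ`. -/
def IsWhitehead2 {k : ℕ} (τ : MulAut (FG k)) : Prop :=
  ∃ a ∈ letterSet k, τ a = a ∧
    ∀ x ∈ letterSet k, τ x = x ∨ τ x = x * a ∨ τ x = a⁻¹ * x ∨ τ x = a⁻¹ * x * a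

/-- An automorphism is inner if it is conjugation by some element. -/
def IsInner {k : ℕ} (α : MulAut (FG k)) : Prop := ∃ g : FG k, α = MulAut.conj g

/-- `SM`: the set of strictly minimal cyclically reduced elements, those `w` with
`‖τ w‖ > |w|` for every non-inner Whitehead automorphism `τ` of the second kind. -/
def SM (k : ℕ) : Set (FG k) :=
  {w | IsCyclicallyReduced w ∧
    ∀ τ : MulAut (FG k), IsWhitehead2 τ → ¬ IsInner τ → wordLength w < cyclicLength (τ w)}

/-- `SM'`: elements whose cyclically reduced form lies in `SM`. -/
def SM' (k : ℕ) : Set (FG k) := {g | ∃ x u : FG k, u ∈ SM k ∧ g = x * u * x⁻¹}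

/-- `γ(n,S)`: the number of elements of `S` of length `n`. -/
noncomputable def gammaC {k : ℕ} (S : Set (FG k)) (n : ℕ) : ℕ :=
  {g ∈ S | wordLength g = n}.ncard

/-- `ρ(n,S)`: the number of elements of `S` of length at most `n`. -/
noncomputable def rhoC {k : ℕ} (S : Set (FG k)) (n : ℕ) : ℕ :=
  {g ∈ S | wordLength g ≤ n}.ncard

/-- `B ⊆ S` is exponentially generic in `S` if `ρ(n,B)/ρ(n,S) → 1`
exponentially fast. -/
def ExpGenericIn {k : ℕ} (B S : Set (FG k)) : Prop :=
  B ⊆ S ∧ ∃ K : ℝ, 0 < K ∧ ∃ σ : ℝ, 0 < σ ∧ σ < 1 ∧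
    ∀ n : ℕ, |1 - (rhoC B n : ℝ) / (rhoC S n : ℝ)| ≤ K * σ ^ n

/-- `B` is exponentially negligible in `S` if `S \ B` is exponentially generic in `S`. -/
def ExpNegligibleIn {k : ℕ} (B S : Set (FG k)) : Prop := ExpGenericIn (S \ B) S

/-- The orbit `Aut(F_k) w`. -/
def autOrbit {k : ℕ} (w : FG k) : Set (FG k) := {g | ∃ α : MulAut (FG k), α w = g}

/-- `u` is a cyclic permutation of `v`: the reduced word of `u` is a rotation of
the reduced word of `v`. -/
def IsCyclicPerm {k : ℕ} (u v : FG k) : Prop :=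
  ∃ n : ℕ, FreeGroup.toWord u = (FreeGroup.toWord v).rotate n

/-- `w` is a proper power: `w = uⁿ` for some `n ≥ 2`. -/
def IsProperPower {k : ℕ} (w : FG k) : Prop := ∃ (u : FG k) (n : ℕ), 2 ≤ n ∧ w = u ^ n

/-- `TS`: strictly minimal cyclically reduced `w` which are not proper powers and
are not conjugate to `τ w` for any nontrivial relabeling automorphism `τ`. -/
def TS (k : ℕ) : Set (FG k) :=
  {w | w ∈ SM k ∧ ¬ IsProperPower w ∧
    ∀ τ : MulAut (FG k), IsRelabeling τ → τ ≠ 1 → ¬ IsConj (τ w) w}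

/-- `TS'`: elements whose cyclically reduced form lies in `TS`. -/
def TS' (k : ℕ) : Set (FG k) := {g | ∃ x u : FG k, u ∈ TS k ∧ g = x * u * x⁻¹}

/-- `Z`: elements of `TS` such that no relabeling automorphism sends `w` to a cyclic
permutation of `w⁻¹`. -/
def Zset (k : ℕ) : Set (FG k) :=
  {w | w ∈ TS k ∧ ¬ ∃ τ : MulAut (FG k), IsRelabeling τ ∧ IsCyclicPerm (τ w) w⁻¹}

/-- Growth entropy `H(S) = limsup ρ(n,S)^{1/n}`. -/
noncomputable def entropyH {k : ℕ} (S : Set (FG k)) : ℝ :=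
  Filter.limsup (fun n : ℕ => (rhoC S n : ℝ) ^ ((n : ℝ)⁻¹)) Filter.atTop

/-- Number of occurrences of the two-letter word `xy` as a subword of `w`. -/
def countPair {k : ℕ} (w : List (Letter k)) (x y : Letter k) : ℕ :=
  (w.zip w.tail).count (x, y)

/-- The label `ŵ_{xy}` of the edge `[x⁻¹, y]` in the weighted Whitehead graph of the
cyclically reduced word `w`: occurrences of `xy` and of `y⁻¹x⁻¹` in `wc`, where `c` is
the first letter of `w`. -/
def whLabel {k : ℕ} (w : List (Letter k)) (x y : Letter k) : ℕ :=
  countPair (w ++ w.take 1) x y + countPair (w ++ w.take 1) (linv y) (linv x)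

/-- The one-relator group `G_u = ⟨a_1,…,a_k ∣ u = 1⟩`. -/
abbrev OneRel (k : ℕ) (u : FG k) := FG k ⧸ Subgroup.normalClosure ({u} : Set (FG k))

/-- `u` is primitive: it belongs to some free basis of `FG k`, equivalently it is the
image of a basis element under an automorphism. -/
def IsPrimitive {k : ℕ} (u : FG k) : Prop :=
  ∃ (α : MulAut (FG k)) (i : Fin k), α (FreeGroup.of i) = u

/-- Reduced words of length `n+1` with first letter `x`. -/
def TW {k : ℕ} : ℕ → Letter k → Finset (List (Letter k))
  | 0, x => {[x]}
  | (n+1), x => ((Finset.univ : Finset (Letter k)).erase (linv x)).biUnion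
      (fun y => (TW n y).image (List.cons x))

theorem linv_linv' {k : ℕ} (x : Letter k) : linv (linv x) = x := by
  simp [linv]

theorem linv_ne' {k : ℕ} (x : Letter k) : linv x ≠ x := by
  intro h
  have := congrArg Prod.snd h
  simp [linv] at this

theorem linv_eq_iff' {k : ℕ} (x y : Letter k) : linv x = y ↔ x = linv y := by
  constructor
  · rintro rfl; rw [linv_linv']
  · rintro rfl; rw [linv_linv']

theorem mem_TW {k : ℕ} (n : ℕ) (x : Letter k) (w : List (Letter k)) :
    w ∈ TW n x ↔ w.length = n + 1 ∧ w.head? = some x ∧ FreeGroup.IsReduced w := by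
  induction n generalizing x w with
  | zero =>
    simp only [TW, Finset.mem_singleton]
    constructor
    · rintro rfl
      simp [FreeGroup.IsReduced]
    · rintro ⟨h1, h2, _⟩
      match w, h1, h2 with
      | [y], _, h2 => simpa using h2
  | succ n ih =>
    simp only [TW, Finset.mem_biUnion, Finset.mem_erase, Finset.mem_univ, and_true,
      Finset.mem_image]
    constructor
    · rintro ⟨y, hy, l, hl, rfl⟩
      obtain ⟨h1, h2, h3⟩ := (ih y l).1 hl
      match l, h1, h2, h3 with
      | z :: l', h1, h2, h3 =>
        have hz : z = y := by simpa using h2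
        subst hz
        refine ⟨by simp at h1 ⊢; omega, by simp, ?_⟩
        unfold FreeGroup.IsReduced at *
        rw [List.isChain_cons_cons]
        refine ⟨?_, h3⟩
        intro hxz
        by_contra hne
        apply hy
        ext
        · simp [linv, hxz]
        · revert hne
          simp only [linv]
          cases x.2 <;> cases z.2 <;> simp
    · rintro ⟨h1, h2, h3⟩
      match w, h1, h2, h3 with
      | x' :: z :: l', h1, h2, h3 =>
        have hz : x' = x := by simpa using h2
        subst hz
        unfold FreeGroup.IsReduced at h3
        rw [List.isChain_cons_cons] at h3
        refine ⟨z, ?_, z :: l', (ih z _).2 ⟨by simpa using h1, by simp, h3.2⟩, rfl⟩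
        rintro rfl
        have := h3.1
        simp [linv] at this

theorem TW_sum {k : ℕ} (n : ℕ) (x : Letter k) (F : List (Letter k) → ℝ) :
    ∑ w ∈ TW (n+1) x, F w =
      ∑ y ∈ (Finset.univ : Finset (Letter k)).erase (linv x), ∑ w ∈ TW n y, F (x :: w) := by
  rw [TW, Finset.sum_biUnion]
  · apply Finset.sum_congr rfl
    intro y _
    rw [Finset.sum_image]
    intro u _ v _ h
    simpa using h
  · intro y _ z _ hyz
    rw [Function.onFun, Finset.disjoint_left]
    intro w hw hw'
    simp only [Finset.mem_image] at hw hw'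
    obtain ⟨u, hu, rfl⟩ := hw
    obtain ⟨v, hv, h⟩ := hw'
    have : v = u := by simpa using h
    subst this
    have h1 := ((mem_TW _ _ _).1 hu).2.1
    have h2 := ((mem_TW _ _ _).1 hv).2.1
    rw [h1] at h2
    exact hyz (by simpa using h2)

theorem card_erase' {k : ℕ} (hk : 2 ≤ k) (x : Letter k) :
    (((Finset.univ : Finset (Letter k)).erase x).card : ℝ) = 2 * (k : ℝ) - 1 := by
  rw [Finset.card_erase_of_mem (Finset.mem_univ _), Finset.card_univ]
  simp only [Fintype.card_prod, Fintype.card_fin, Fintype.card_bool]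
  rw [Nat.cast_sub (by omega)]
  push_cast; ring

theorem card_TW {k : ℕ} (hk : 2 ≤ k) (n : ℕ) (x : Letter k) :
    ((TW n x).card : ℝ) = (2 * (k : ℝ) - 1) ^ n := by
  induction n generalizing x with
  | zero => simp [TW]
  | succ n ih =>
    have := TW_sum n x (fun _ => 1)
    simp only [Finset.sum_const, nsmul_eq_mul, mul_one] at this
    rw [this, Finset.sum_congr rfl (fun y _ => ih y), Finset.sum_const, nsmul_eq_mul,
      card_erase' hk]
    ring

theorem countPair_cons {k : ℕ} (a b x y : Letter k) (l : List (Letter k))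
    (h : l.head? = some y) :
    (countPair (x :: l) a b : ℝ) = (if x = a ∧ y = b then 1 else 0) + countPair l a b := by
  match l, h with
  | z :: l', h =>
    have hz : z = y := by simpa using h
    subst hz
    simp only [countPair, List.tail_cons, List.zip_cons_cons, List.count_cons]
    by_cases hx : x = a <;> by_cases hy : z = b <;> simp [hx, hy] <;> ring

/-- Corrector. -/
noncomputable def corr {k : ℕ} (m : ℝ) (a x : Letter k) : ℝ :=
  m / (m^2 - 1) * (if x = a then 1 else 0) - 1 / (m^2 - 1) * (if x = linv a then 1 else 0)

theorem corr_bd {k : ℕ} (m : ℝ) (hm : 3 ≤ m) (a x : Letter k) : |corr m a x| ≤ 3/8 := by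
  have h1 : 0 < m^2 - 1 := by nlinarith
  have h2 : m / (m^2-1) ≤ 3/8 := by rw [div_le_iff₀ h1]; nlinarith
  have h3 : 1 / (m^2-1) ≤ 3/8 := by rw [div_le_iff₀ h1]; nlinarith
  have h4 : 0 ≤ m / (m^2-1) := by positivity
  have h5 : 0 ≤ 1 / (m^2-1) := by positivity
  unfold corr
  rw [abs_le]
  split_ifs <;> constructor <;> linarith

theorem corr_sum {k : ℕ} (hk : 2 ≤ k) (a b x : Letter k) (hab : b ≠ linv a) (m : ℝ)
    (hm : m = 2 * (k : ℝ) - 1) (p : ℝ) (hp : p = 1 / (2 * (k:ℝ) * (2 * (k:ℝ) - 1))) :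
    ∑ y ∈ (Finset.univ : Finset (Letter k)).erase (linv x),
      ((if x = a ∧ y = b then (1:ℝ) else 0) - p + corr m a y - corr m a x) = 0 := by
  have hk' : (2:ℝ) ≤ k := by exact_mod_cast hk
  have hm3 : 3 ≤ m := by linarith
  have hp' : p = 1 / ((m+1) * m) := by rw [hp, hm]; ring_nf
  have h1 : m^2 - 1 ≠ 0 := by nlinarith
  have hm0 : m ≠ 0 := by linarith
  have hm1 : m + 1 ≠ 0 := by linarith
  have e1 : ∑ y ∈ (Finset.univ : Finset (Letter k)).erase (linv x),
      (if x = a ∧ y = b then (1:ℝ) else 0) = if x = a then 1 else 0 := by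
    by_cases hx : x = a
    · subst hx
      simp [hab]
    · simp [hx]
  have e2 : ∀ c : Letter k, ∑ y ∈ (Finset.univ : Finset (Letter k)).erase (linv x),
      (if y = c then (1:ℝ) else 0) = 1 - if x = linv c then 1 else 0 := by
    intro c
    have h := Finset.sum_erase_eq_sub (f := fun y => if y = c then (1:ℝ) else 0)
      (Finset.mem_univ (linv x))
    rw [h]
    simp [linv_eq_iff']
  rw [Finset.sum_sub_distrib, Finset.sum_add_distrib, Finset.sum_sub_distrib, e1,
    Finset.sum_const, Finset.sum_const, nsmul_eq_mul, nsmul_eq_mul, card_erase' hk, ← hm]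
  unfold corr
  rw [Finset.sum_sub_distrib, ← Finset.mul_sum, ← Finset.mul_sum, e2, e2, linv_linv', hp']
  generalize (if x = a then (1:ℝ) else 0) = u
  generalize (if x = linv a then (1:ℝ) else 0) = v
  have h1' : m^2-1 = (m-1)*(m+1) := by ring
  have hmm : m - 1 ≠ 0 := by linarith
  rw [h1']
  field_simp
  ring

theorem exp_bd (s : ℝ) (hs : |s| ≤ 1) : Real.exp s ≤ 1 + s + s^2 := by
  have := Real.abs_exp_sub_one_sub_id_le hs
  have := (abs_le.1 this).2
  linarith

theorem step_bd {k : ℕ} (hk : 2 ≤ k) (a b x : Letter k) (hab : b ≠ linv a) (m : ℝ)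
    (hm : m = 2 * (k : ℝ) - 1) (p : ℝ) (hp : p = 1 / (2 * (k:ℝ) * (2 * (k:ℝ) - 1)))
    (t : ℝ) (ht : |t| ≤ 1/2) :
    ∑ y ∈ (Finset.univ : Finset (Letter k)).erase (linv x),
      Real.exp (t * ((if x = a ∧ y = b then (1:ℝ) else 0) - p + corr m a y - corr m a x))
      ≤ m * Real.exp (4 * t^2) := by
  have hk' : (2:ℝ) ≤ k := by exact_mod_cast hk
  have hm3 : 3 ≤ m := by linarith
  have hp0 : 0 ≤ p := by rw [hp]; apply div_nonneg <;> nlinarith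
  have hp1 : p ≤ 1 := by
    rw [hp, div_le_one] <;> nlinarith
  have hD : ∀ y, |((if x = a ∧ y = b then (1:ℝ) else 0) - p + corr m a y - corr m a x)| ≤ 2 := by
    intro y
    have h1 := abs_le.1 (corr_bd m hm3 a y)
    have h2 := abs_le.1 (corr_bd m hm3 a x)
    rw [abs_le]
    split_ifs <;> constructor <;> linarith
  calc _ ≤ ∑ y ∈ (Finset.univ : Finset (Letter k)).erase (linv x),
      ((1 + 4*t^2) + t * ((if x = a ∧ y = b then (1:ℝ) else 0) - p + corr m a y - corr m a x)) := by
        apply Finset.sum_le_sum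
        intro y _
        have h := hD y
        set D := ((if x = a ∧ y = b then (1:ℝ) else 0) - p + corr m a y - corr m a x)
        have h1 : |t * D| ≤ 1 := by
          rw [abs_mul]
          nlinarith [abs_nonneg t, abs_nonneg D]
        have h2 := exp_bd _ h1
        have h3 : D^2 ≤ 4 := by nlinarith [abs_le.1 h]
        nlinarith [sq_nonneg t]
    _ = m * (4 * t^2 + 1) := by
        rw [Finset.sum_add_distrib, ← Finset.mul_sum, corr_sum hk a b x hab m hm p hp,
          Finset.sum_const, nsmul_eq_mul, card_erase' hk, ← hm]
        ring
    _ ≤ _ := by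
        apply mul_le_mul_of_nonneg_left (Real.add_one_le_exp _) (by linarith)

theorem moment_bd {k : ℕ} (hk : 2 ≤ k) (a b : Letter k) (hab : b ≠ linv a) (m : ℝ)
    (hm : m = 2 * (k : ℝ) - 1) (p : ℝ) (hp : p = 1 / (2 * (k:ℝ) * (2 * (k:ℝ) - 1)))
    (t : ℝ) (ht : |t| ≤ 1/2) (n : ℕ) (x : Letter k) :
    ∑ w ∈ TW n x, Real.exp (t * countPair w a b) ≤
      m ^ n * Real.exp ((4 * t^2 + t * p) * n + t * corr m a x + |t|) := by
  have hk' : (2:ℝ) ≤ k := by exact_mod_cast hk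
  have hm3 : 3 ≤ m := by linarith
  induction n generalizing x with
  | zero =>
    simp only [TW, Finset.sum_singleton, countPair]
    simp
    have h := corr_bd m hm3 a x
    have h2 : |t * corr m a x| ≤ |t| := by
      rw [abs_mul]; nlinarith [abs_nonneg t]
    linarith [abs_le.1 h2]
  | succ n ih =>
    rw [TW_sum]
    calc _ = ∑ y ∈ (Finset.univ : Finset (Letter k)).erase (linv x),
        Real.exp (t * (if x = a ∧ y = b then (1:ℝ) else 0)) *
          ∑ w ∈ TW n y, Real.exp (t * countPair w a b) := by
          apply Finset.sum_congr rfl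
          intro y _
          rw [Finset.mul_sum]
          apply Finset.sum_congr rfl
          intro w hw
          rw [countPair_cons a b x y w ((mem_TW _ _ _).1 hw).2.1, ← Real.exp_add, mul_add]
      _ ≤ ∑ y ∈ (Finset.univ : Finset (Letter k)).erase (linv x),
        Real.exp (t * (if x = a ∧ y = b then (1:ℝ) else 0)) *
          (m ^ n * Real.exp ((4 * t^2 + t * p) * n + t * corr m a y + |t|)) := by
          apply Finset.sum_le_sum
          intro y _
          exact mul_le_mul_of_nonneg_left (ih y) (Real.exp_pos _).le
      _ = (m ^ n * Real.exp ((4 * t^2 + t * p) * n + t * p + t * corr m a x + |t|)) *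
        ∑ y ∈ (Finset.univ : Finset (Letter k)).erase (linv x),
         Real.exp (t * ((if x = a ∧ y = b then (1:ℝ) else 0) - p + corr m a y - corr m a x)) := by
          rw [Finset.mul_sum]
          apply Finset.sum_congr rfl
          intro y _
          rw [mul_left_comm, mul_assoc, ← Real.exp_add, ← Real.exp_add]
          congr 2
          ring
      _ ≤ (m ^ n * Real.exp ((4 * t^2 + t * p) * n + t * p + t * corr m a x + |t|)) *
          (m * Real.exp (4 * t^2)) := by
          apply mul_le_mul_of_nonneg_left (step_bd hk a b x hab m hm p hp t ht)
          positivity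
      _ = _ := by
          rw [mul_mul_mul_comm, ← Real.exp_add, pow_succ]
          congr 2
          push_cast; ring

/-- All reduced words of length `n+1`. -/
def AW (k n : ℕ) : Finset (List (Letter k)) := Finset.univ.biUnion (fun x => TW n x)

theorem mem_AW {k : ℕ} (n : ℕ) (w : List (Letter k)) :
    w ∈ AW k n ↔ w.length = n + 1 ∧ FreeGroup.IsReduced w := by
  simp only [AW, Finset.mem_biUnion, Finset.mem_univ, true_and, mem_TW]
  constructor
  · rintro ⟨x, h1, _, h3⟩; exact ⟨h1, h3⟩
  · rintro ⟨h1, h3⟩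
    match w, h1 with
    | x :: l, h1 => exact ⟨x, h1, rfl, h3⟩

theorem AW_sum {k : ℕ} (n : ℕ) (F : List (Letter k) → ℝ) :
    ∑ w ∈ AW k n, F w = ∑ x, ∑ w ∈ TW n x, F w := by
  rw [AW, Finset.sum_biUnion]
  intro y _ z _ hyz
  rw [Function.onFun, Finset.disjoint_left]
  intro w hu hv
  have h1 := ((mem_TW _ _ _).1 hu).2.1
  have h2 := ((mem_TW _ _ _).1 hv).2.1
  rw [h1] at h2
  exact hyz (by simpa using h2)

theorem card_AW {k : ℕ} (hk : 2 ≤ k) (n : ℕ) :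
    ((AW k n).card : ℝ) = 2 * (k : ℝ) * (2 * (k : ℝ) - 1) ^ n := by
  have := AW_sum (k := k) n (fun _ => 1)
  simp only [Finset.sum_const, nsmul_eq_mul, mul_one] at this
  rw [this, Finset.sum_congr rfl (fun y _ => card_TW hk n y), Finset.sum_const, nsmul_eq_mul]
  simp; left; ring

theorem AW_moment {k : ℕ} (hk : 2 ≤ k) (a b : Letter k) (hab : b ≠ linv a)
    (p : ℝ) (hp : p = 1 / (2 * (k:ℝ) * (2 * (k:ℝ) - 1)))
    (t : ℝ) (ht : |t| ≤ 1/2) (n : ℕ) :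
    ∑ w ∈ AW k n, Real.exp (t * countPair w a b) ≤
      (AW k n).card * Real.exp ((4 * t^2 + t * p) * n + 2 * |t|) := by
  have hk' : (2:ℝ) ≤ k := by exact_mod_cast hk
  rw [AW_sum, card_AW hk]
  have hm3 : 3 ≤ 2 * (k : ℝ) - 1 := by linarith
  calc _ ≤ ∑ x : Letter k, (2 * (k : ℝ) - 1) ^ n * Real.exp ((4 * t^2 + t * p) * n + 2 * |t|) := by
        apply Finset.sum_le_sum
        intro x _
        refine (moment_bd hk a b hab _ rfl p hp t ht n x).trans ?_
        apply mul_le_mul_of_nonneg_left _ (pow_nonneg (by linarith) _)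
        apply Real.exp_le_exp.2
        have h := corr_bd _ hm3 a x
        have h2 : |t * corr (2 * (k : ℝ) - 1) a x| ≤ |t| := by
          rw [abs_mul]; nlinarith [abs_nonneg t]
        linarith [abs_le.1 h2]
    _ = _ := by
        rw [Finset.sum_const, nsmul_eq_mul]
        simp only [Finset.card_univ, Fintype.card_prod, Fintype.card_fin, Fintype.card_bool]
        push_cast; ring

theorem ncard_AW {k : ℕ} (n : ℕ) (P : List (Letter k) → Prop) [DecidablePred P] :
    {g : FG k | wordLength g = n + 1 ∧ P (FreeGroup.toWord g)}.ncard =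
      ((AW k n).filter P).card := by
  rw [← Set.ncard_coe_finset, ← Set.ncard_image_of_injective _ FreeGroup.toWord_injective]
  congr 1
  ext w
  simp only [Set.mem_image, Set.mem_ofPred_eq, Finset.coe_filter, mem_AW, wordLength]
  constructor
  · rintro ⟨g, ⟨h1, h2⟩, rfl⟩
    exact ⟨⟨h1, FreeGroup.isReduced_toWord⟩, h2⟩
  · rintro ⟨⟨h1, h2⟩, h3⟩
    have : FreeGroup.toWord (FreeGroup.mk w) = w := by
      rw [FreeGroup.toWord_mk]
      exact FreeGroup.isReduced_iff_reduce_eq.1 h2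
    exact ⟨FreeGroup.mk w, by rw [this]; exact ⟨h1, h3⟩, this⟩

theorem bad_bd {k : ℕ} (hk : 2 ≤ k) (a b : Letter k) (hab : b ≠ linv a)
    (p : ℝ) (hp : p = 1 / (2 * (k:ℝ) * (2 * (k:ℝ) - 1))) (ε : ℝ)
    (t : ℝ) (ht0 : 0 < t) (ht : t ≤ 1/2) (htε : 8 * t ≤ ε) (n : ℕ)
    (P : List (Letter k) → Prop) [DecidablePred P]
    (hP : ∀ w, P w ↔ p - ε < (countPair w a b : ℝ) / (n + 1 : ℕ) ∧
      (countPair w a b : ℝ) / (n + 1 : ℕ) < p + ε) :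
    (((AW k n).filter (fun w => ¬ P w)).card : ℝ) ≤
      (AW k n).card * (2 * Real.exp 2 * Real.exp (-(t * ε / 2)) ^ (n+1)) := by
  have hk' : (2:ℝ) ≤ k := by exact_mod_cast hk
  have hp0 : 0 ≤ p := by rw [hp]; apply div_nonneg <;> nlinarith
  have hp1 : p ≤ 1 := by
    rw [hp, div_le_one] <;> nlinarith
  set N : ℝ := (n : ℝ) with hN
  have hN0 : 0 ≤ N := by positivity
  have h1 := AW_moment hk a b hab p hp t (by rw [abs_of_pos ht0]; exact ht) n
  have h2 := AW_moment hk a b hab p hp (-t) (by rw [abs_neg, abs_of_pos ht0]; exact ht) n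
  rw [abs_of_pos ht0] at h1
  rw [abs_neg, abs_of_pos ht0] at h2
  set E1 := Real.exp (- (t * (p + ε) * (N+1)))
  set E2 := Real.exp (t * (p - ε) * (N+1))
  calc (((AW k n).filter (fun w => ¬ P w)).card : ℝ)
      = ∑ w ∈ (AW k n).filter (fun w => ¬ P w), (1:ℝ) := by simp
    _ ≤ ∑ w ∈ (AW k n).filter (fun w => ¬ P w),
        (E1 * Real.exp (t * countPair w a b) + E2 * Real.exp (-t * countPair w a b)) := by
        apply Finset.sum_le_sum
        intro w hw
        have hw := (Finset.mem_filter.1 hw).2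
        rw [hP, not_and_or, not_lt, not_lt] at hw
        have hpos : (0:ℝ) < ((n + 1 : ℕ) : ℝ) := by positivity
        rw [div_le_iff₀ hpos, le_div_iff₀ hpos] at hw
        push_cast at hw
        rw [← hN] at hw
        have e1 : E1 * Real.exp (t * countPair w a b) =
            Real.exp (t * (countPair w a b - (p+ε) * (N+1))) := by
          rw [← Real.exp_add]; congr 1; ring
        have e2 : E2 * Real.exp (-t * countPair w a b) =
            Real.exp (t * ((p-ε) * (N+1) - countPair w a b)) := by
          rw [← Real.exp_add]; congr 1; ring
        rw [e1, e2]
        rcases hw with hw | hw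
        · have := Real.one_le_exp (mul_nonneg ht0.le (sub_nonneg.2 hw))
          have := Real.exp_pos (t * (countPair w a b - (p+ε) * (N+1)))
          linarith
        · have := Real.one_le_exp (mul_nonneg ht0.le (sub_nonneg.2 hw))
          have := Real.exp_pos (t * ((p-ε) * (N+1) - countPair w a b))
          linarith
    _ ≤ ∑ w ∈ AW k n,
        (E1 * Real.exp (t * countPair w a b) + E2 * Real.exp (-t * countPair w a b)) := by
        apply Finset.sum_le_sum_of_subset_of_nonneg (Finset.filter_subset _ _)
        intro w _ _
        positivity
    _ ≤ E1 * ((AW k n).card * Real.exp ((4 * t^2 + t * p) * N + 2 * t)) +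
        E2 * ((AW k n).card * Real.exp ((4 * (-t)^2 + (-t) * p) * N + 2 * t)) := by
        rw [Finset.sum_add_distrib, ← Finset.mul_sum, ← Finset.mul_sum]
        gcongr
    _ = (AW k n).card * (Real.exp (- (t * (p + ε) * (N+1)) + ((4 * t^2 + t * p) * N + 2 * t)) +
        Real.exp (t * (p - ε) * (N+1) + ((4 * (-t)^2 + (-t) * p) * N + 2 * t))) := by
        rw [Real.exp_add (- (t * (p + ε) * (N+1))), Real.exp_add (t * (p - ε) * (N+1))]
        ring
    _ ≤ (AW k n).card * (Real.exp (2 + (n+1 : ℕ) * (-(t * ε / 2))) +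
          Real.exp (2 + (n+1 : ℕ) * (-(t * ε / 2)))) := by
        have q1 : 4 * t^2 ≤ t * ε / 2 := by nlinarith
        have q2 : 4 * t^2 * N ≤ t * ε / 2 * N := mul_le_mul_of_nonneg_right q1 hN0
        have q3 : 0 ≤ t * p := by positivity
        have q4 : t * p ≤ 1/2 := by nlinarith
        have q5 : 0 ≤ t * ε := by nlinarith
        push_cast
        rw [← hN]
        refine mul_le_mul_of_nonneg_left (add_le_add (Real.exp_le_exp.2 ?_)
          (Real.exp_le_exp.2 ?_)) (Nat.cast_nonneg _)
        · nlinarith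
        · nlinarith
    _ = _ := by
        rw [Real.exp_add, Real.exp_nat_mul]
        ring

/-- for letters `a, b ∈ Σ` with `b ≠ a⁻¹` and any `ε > 0`, the proportion
of freely reduced words of length `n` with `w_{ab}/n ∈ (1/(2k(2k−1)) − ε, 1/(2k(2k−1)) + ε)`
tends to `1` exponentially fast. -/
theorem pair_frequency_generic (k : ℕ) (hk : 2 ≤ k) (a b : Letter k)
    (hab : b ≠ linv a) (ε : ℝ) (hε : 0 < ε) :
    ∃ K : ℝ, 0 < K ∧ ∃ σ : ℝ, 0 < σ ∧ σ < 1 ∧ ∀ n : ℕ,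
      |1 - ({g : FG k | wordLength g = n ∧
          1 / (2 * (k : ℝ) * (2 * (k : ℝ) - 1)) - ε
            < (countPair (FreeGroup.toWord g) a b : ℝ) / n ∧
          (countPair (FreeGroup.toWord g) a b : ℝ) / n
            < 1 / (2 * (k : ℝ) * (2 * (k : ℝ) - 1)) + ε}.ncard : ℝ) /
        (gammaC (Set.univ : Set (FG k)) n : ℝ)| ≤ K * σ ^ n := by
  classical
  obtain ⟨t, ht0, ht, htε⟩ : ∃ t : ℝ, 0 < t ∧ t ≤ 1/2 ∧ 8 * t ≤ ε := by
    refine ⟨min (1/2) (ε/8), by positivity, min_le_left _ _, ?_⟩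
    have := min_le_right (1/2) (ε/8)
    linarith
  refine ⟨2 * Real.exp 2, by positivity, Real.exp (-(t * ε / 2)), Real.exp_pos _, ?_, ?_⟩
  · rw [Real.exp_lt_one_iff]
    have : 0 < t * ε := by positivity
    linarith
  intro n
  rcases n with _ | n
  · have hfin : {g ∈ (Set.univ : Set (FG k)) | wordLength g = 0} = {1} := by
      ext g
      simp [wordLength]
    have hT : gammaC (Set.univ : Set (FG k)) 0 = 1 := by
      rw [gammaC, hfin]; simp
    rw [hT]
    have hle : {g : FG k | wordLength g = 0 ∧
          1 / (2 * (k : ℝ) * (2 * (k : ℝ) - 1)) - ε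
            < (countPair (FreeGroup.toWord g) a b : ℝ) / (0 : ℕ) ∧
          (countPair (FreeGroup.toWord g) a b : ℝ) / (0 : ℕ)
            < 1 / (2 * (k : ℝ) * (2 * (k : ℝ) - 1)) + ε}.ncard ≤ 1 := by
      refine le_trans (Set.ncard_le_ncard
        (t := {g ∈ (Set.univ : Set (FG k)) | wordLength g = 0}) ?_ ?_) (le_of_eq hT)
      · intro g hg; exact ⟨Set.mem_univ _, hg.1⟩
      · rw [hfin]; exact Set.finite_singleton _
    have hle' : _ ≤ (1:ℝ) := Nat.cast_le_one.2 hle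
    have h2 := Real.one_le_exp (show (0:ℝ) ≤ 2 by norm_num)
    rw [abs_le]
    rw [Nat.cast_one, div_one, pow_zero]
    constructor
    · linarith
    · refine le_trans (sub_le_self _ (Nat.cast_nonneg _)) ?_
      linarith
  · have hk' : (2:ℝ) ≤ k := by exact_mod_cast hk
    set p := 1 / (2 * (k : ℝ) * (2 * (k : ℝ) - 1)) with hp
    have hB := bad_bd hk a b hab p hp ε t ht0 ht htε n
      (fun w => p - ε < (countPair w a b : ℝ) / (n + 1 : ℕ) ∧
      (countPair w a b : ℝ) / (n + 1 : ℕ) < p + ε) (fun w => Iff.rfl)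
    have hG := ncard_AW n (fun w => p - ε < (countPair w a b : ℝ) / (n + 1 : ℕ) ∧
      (countPair w a b : ℝ) / (n + 1 : ℕ) < p + ε)
    have hT : gammaC (Set.univ : Set (FG k)) (n+1) = (AW k n).card := by
      have := ncard_AW (k := k) n (fun _ => True)
      simpa [gammaC] using this
    have hc : (0:ℝ) < (AW k n).card := by
      rw [card_AW hk]
      have : (0:ℝ) < 2 * (k:ℝ) - 1 := by linarith
      positivity
    rw [hG, hT]
    have hs := Finset.card_filter_add_card_filter_not (s := AW k n)
      (fun w => p - ε < (countPair w a b : ℝ) / (n + 1 : ℕ) ∧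
      (countPair w a b : ℝ) / (n + 1 : ℕ) < p + ε)
    have hs' : ((((AW k n).filter (fun w => p - ε < (countPair w a b : ℝ) / (n + 1 : ℕ) ∧
      (countPair w a b : ℝ) / (n + 1 : ℕ) < p + ε)).card : ℝ)) + (((AW k n).filter (fun w =>
      ¬ (p - ε < (countPair w a b : ℝ) / (n + 1 : ℕ) ∧
      (countPair w a b : ℝ) / (n + 1 : ℕ) < p + ε))).card : ℝ) = (AW k n).card := by
      exact_mod_cast hs
    rw [one_sub_div hc.ne', ← hs', add_sub_cancel_left, hs', abs_of_nonneg (by positivity),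
      div_le_iff₀ hc, mul_comm]
    exact hB
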